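/- Let m, σ, ε > 0, let q < q' be real numbers with Δ' = q' - q and q̄ = (q + q')/2, and suppose σ²ε/Δ' ≤ Δ'/2 + m. Let y* = q̄ - εσ²/(Δ' + 2m). Then ∫_{-∞}^{y*} (f_q(y) - e^ε·f_{q'}(y)) dy = 1 - (1/(2Q(m/σ)))·(Q((2m+Δ')/(2σ) - εσ/(Δ'+2m)) + e^ε·Q((2m+Δ')/(2σ) + εσ/(Δ'+2m))). -/

import Mathlib

open MeasureTheory Real Filter Set

/-- The Gaussian Q-function: `Q x = (1/√(2π)) ∫_x^∞ exp (-t²/2) dt`. -/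
noncomputable def gaussQ (x : ℝ) : ℝ :=
  (1 / Real.sqrt (2 * Real.pi)) * ∫ t in Set.Ioi x, Real.exp (-t ^ 2 / 2)

/-- The standard normal CDF: `Φ x = (1/√(2π)) ∫_{-∞}^x exp (-t²/2) dt`. -/
noncomputable def stdPhi (x : ℝ) : ℝ :=
  (1 / Real.sqrt (2 * Real.pi)) * ∫ t in Set.Iic x, Real.exp (-t ^ 2 / 2)

/-- The offset-symmetric Gaussian tails (OSGT) density with parameters `m`, `σ`,
with normalization constant `S = 2√(2πσ²) Q(m/σ)`. -/
noncomputable def osgt (m σ y : ℝ) : ℝ :=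
  if y ≤ 0 then
    Real.exp (-(y - m) ^ 2 / (2 * σ ^ 2)) /
      (2 * Real.sqrt (2 * Real.pi * σ ^ 2) * gaussQ (m / σ))
  else
    Real.exp (-(y + m) ^ 2 / (2 * σ ^ 2)) /
      (2 * Real.sqrt (2 * Real.pi * σ ^ 2) * gaussQ (m / σ))

/-- The Gaussian kernel is integrable. -/
lemma integrable_exp_neg_sq_div_two : Integrable fun t : ℝ => Real.exp (-t ^ 2 / 2) := by
  refine (integrable_exp_neg_mul_sq (b := 1 / 2) (by norm_num)).congr (ae_of_all _ fun t => ?_)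
  ring_nf

lemma gaussQ_pos (x : ℝ) : 0 < gaussQ x := by
  refine mul_pos (by positivity) ?_
  rw [setIntegral_pos_iff_support_of_nonneg_ae (ae_of_all _ fun t => (Real.exp_pos _).le)
    integrable_exp_neg_sq_div_two.integrableOn]
  have hsupp : Function.support (fun t : ℝ => Real.exp (-t ^ 2 / 2)) = Set.univ :=
    Set.eq_univ_of_forall fun t => (Real.exp_pos _).ne'
  simp [hsupp]

/-- The upper tail integral of a shifted and scaled Gaussian kernel. -/
lemma integral_Ioi_exp_neg_add_sq_div (m a : ℝ) {σ : ℝ} (hσ : 0 < σ) :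
    ∫ y in Set.Ioi a, Real.exp (-(y + m) ^ 2 / (2 * σ ^ 2)) =
      Real.sqrt (2 * Real.pi * σ ^ 2) * gaussQ ((a + m) / σ) := by
  have hshift := (measurePreserving_add_right volume m).setIntegral_preimage_emb
    (measurableEmbedding_addRight m)
    (fun y : ℝ => Real.exp (-(σ⁻¹ * y) ^ 2 / 2)) (Set.Ioi (a + m))
  have hscale := integral_comp_mul_left_Ioi (fun t : ℝ => Real.exp (-t ^ 2 / 2)) (a + m)
    (inv_pos.mpr hσ)
  have hpre : (fun y : ℝ => y + m) ⁻¹' Set.Ioi (a + m) = Set.Ioi a := by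
    ext y
    simp
  have hexp : ∀ y : ℝ, Real.exp (-(σ⁻¹ * (y + m)) ^ 2 / 2) =
      Real.exp (-(y + m) ^ 2 / (2 * σ ^ 2)) := fun y => by
    congr 1
    field_simp
  simp only [hpre, hexp] at hshift
  rw [hshift, hscale, gaussQ, Real.sqrt_mul (by positivity), Real.sqrt_sq hσ.le, inv_inv,
    smul_eq_mul, inv_mul_eq_div]
  have : Real.sqrt (2 * Real.pi) ≠ 0 := by positivity
  field_simp

lemma integrable_exp_neg_add_sq_div (m : ℝ) {σ : ℝ} (hσ : 0 < σ) :
    Integrable fun y : ℝ => Real.exp (-(y + m) ^ 2 / (2 * σ ^ 2)) := by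
  refine ((integrable_exp_neg_mul_sq (b := (2 * σ ^ 2)⁻¹) (by positivity)).comp_add_right
    m).congr (ae_of_all _ fun y => ?_)
  simp only
  congr 1
  ring

lemma osgt_neg (m σ y : ℝ) : osgt m σ (-y) = osgt m σ y := by
  unfold osgt
  rcases lt_trichotomy y 0 with h | rfl | h
  · rw [if_neg (by linarith), if_pos h.le]
    ring_nf
  · simp
  · rw [if_pos (by linarith), if_neg (by linarith)]
    ring_nf

lemma osgt_of_pos (m σ : ℝ) {y : ℝ} (hy : 0 < y) :
    osgt m σ y = Real.exp (-(y + m) ^ 2 / (2 * σ ^ 2)) /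
      (2 * Real.sqrt (2 * Real.pi * σ ^ 2) * gaussQ (m / σ)) :=
  if_neg hy.not_ge

lemma integrable_osgt (m : ℝ) {σ : ℝ} (hσ : 0 < σ) : Integrable (osgt m σ) := by
  have hneg := (integrable_exp_neg_add_sq_div (-m) hσ).div_const
    (2 * Real.sqrt (2 * Real.pi * σ ^ 2) * gaussQ (m / σ))
  have hpos := (integrable_exp_neg_add_sq_div m hσ).div_const
    (2 * Real.sqrt (2 * Real.pi * σ ^ 2) * gaussQ (m / σ))
  simp only [← sub_eq_add_neg] at hneg
  classical
  refine (Integrable.piecewise (s := Set.Iic 0) measurableSet_Iic hneg.integrableOn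
    hpos.integrableOn).congr (ae_of_all _ fun y => ?_)
  simp only [Set.piecewise, osgt, Set.mem_Iic]

/-- The upper tail of the OSGT distribution. -/
lemma integral_Ioi_osgt (m : ℝ) {σ a : ℝ} (hσ : 0 < σ) (ha : 0 ≤ a) :
    ∫ y in Set.Ioi a, osgt m σ y = gaussQ ((a + m) / σ) / (2 * gaussQ (m / σ)) := by
  rw [setIntegral_congr_fun measurableSet_Ioi
    fun y (hy : a < y) => osgt_of_pos m σ (ha.trans_lt hy), integral_div,
    integral_Ioi_exp_neg_add_sq_div m a hσ]
  have := (gaussQ_pos (m / σ)).ne'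
  have : Real.sqrt (2 * Real.pi * σ ^ 2) ≠ 0 := by positivity
  field_simp

/-- The lower tail of the OSGT distribution. -/
lemma integral_Iic_osgt_of_nonpos (m : ℝ) {σ b : ℝ} (hσ : 0 < σ) (hb : b ≤ 0) :
    ∫ y in Set.Iic b, osgt m σ y = gaussQ ((m - b) / σ) / (2 * gaussQ (m / σ)) := by
  have h := integral_comp_neg_Iic b (osgt m σ)
  simp only [osgt_neg] at h
  rw [h, integral_Ioi_osgt m hσ (neg_nonneg.mpr hb), neg_add_eq_sub]

/-- The OSGT density has total mass one. -/
lemma integral_osgt (m : ℝ) {σ : ℝ} (hσ : 0 < σ) : ∫ y, osgt m σ y = 1 := by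
  have hint := integrable_osgt m hσ
  rw [← intervalIntegral.integral_Iic_add_Ioi (b := 0) hint.integrableOn hint.integrableOn,
    integral_Iic_osgt_of_nonpos m hσ le_rfl, integral_Ioi_osgt m hσ le_rfl, sub_zero, zero_add]
  have := (gaussQ_pos (m / σ)).ne'
  field_simp
  norm_num

lemma integral_Iic_osgt_of_nonneg (m : ℝ) {σ a : ℝ} (hσ : 0 < σ) (ha : 0 ≤ a) :
    ∫ y in Set.Iic a, osgt m σ y = 1 - gaussQ ((a + m) / σ) / (2 * gaussQ (m / σ)) := by
  have hint := integrable_osgt m hσ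
  rw [← integral_osgt m hσ, ← integral_Ioi_osgt m hσ ha, eq_sub_iff_add_eq]
  exact intervalIntegral.integral_Iic_add_Ioi hint.integrableOn hint.integrableOn

lemma setIntegral_Iic_comp_sub_right (f : ℝ → ℝ) (a c : ℝ) :
    ∫ y in Set.Iic a, f (y - c) = ∫ y in Set.Iic (a - c), f y := by
  have h := (measurePreserving_sub_right volume c).setIntegral_preimage_emb
    (MeasurableEquiv.subRight c).measurableEmbedding f (Set.Iic (a - c))
  rwa [show (fun y : ℝ => y - c) ⁻¹' Set.Iic (a - c) = Set.Iic a by ext y; simp] at h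

/-- the value of `δ` in the small-`ε` regime. -/
theorem osgt_delta_small_eps (m σ ε : ℝ) (hm : 0 < m) (hσ : 0 < σ) (hε : 0 < ε)
    (q q' : ℝ) (hqq : q < q')
    (Δ' qbar : ℝ) (hΔ' : Δ' = q' - q) (hqbar : qbar = (q + q') / 2)
    (hcase : σ ^ 2 * ε / Δ' ≤ Δ' / 2 + m)
    (ystar : ℝ) (hystar : ystar = qbar - ε * σ ^ 2 / (Δ' + 2 * m)) :
    ∫ y in Set.Iic ystar, (osgt m σ (y - q) - Real.exp ε * osgt m σ (y - q')) =
      1 - (1 / (2 * gaussQ (m / σ))) *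
        (gaussQ ((2 * m + Δ') / (2 * σ) - ε * σ / (Δ' + 2 * m)) +
          Real.exp ε * gaussQ ((2 * m + Δ') / (2 * σ) + ε * σ / (Δ' + 2 * m))) := by
  have hΔ : 0 < Δ' := by linarith
  have hD : 0 < Δ' + 2 * m := by linarith
  have hthr : ε * σ ^ 2 / (Δ' + 2 * m) ≤ Δ' / 2 := by
    rw [div_le_iff₀ hΔ] at hcase
    rw [div_le_iff₀ hD]
    linarith
  have hpos : 0 ≤ ε * σ ^ 2 / (Δ' + 2 * m) := by positivity
  have hint := integrable_osgt m hσ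
  rw [integral_sub (hint.comp_sub_right q).integrableOn
      ((hint.comp_sub_right q').const_mul _).integrableOn, integral_const_mul,
    setIntegral_Iic_comp_sub_right, setIntegral_Iic_comp_sub_right,
    integral_Iic_osgt_of_nonneg m hσ (by linarith),
    integral_Iic_osgt_of_nonpos m hσ (by linarith)]
  have hq : (ystar - q + m) / σ = (2 * m + Δ') / (2 * σ) - ε * σ / (Δ' + 2 * m) := by
    rw [show ystar - q = Δ' / 2 - ε * σ ^ 2 / (Δ' + 2 * m) by linarith]
    field_simp
    ring
  have hq' : (m - (ystar - q')) / σ = (2 * m + Δ') / (2 * σ) + ε * σ / (Δ' + 2 * m) := by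
    rw [show ystar - q' = -(Δ' / 2) - ε * σ ^ 2 / (Δ' + 2 * m) by linarith]
    field_simp
    ring
  rw [hq, hq']
  ring
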